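/- arXiv:1004.2908 — 8 statements merged into one kernel-verified Lean document; each statement's English description precedes it below -/
import Mathlib

section
/- Let H be a digraph. If u, v is an invertible pair in H and (p,q) lies in the same strong component of H^+ as (u,v), then p, q is also an invertible pair in H. -/
variable {V : Type*}

/-- A `+` arc of the pair digraph `H⁺`: from `(u,v)` to `(u',v')` when
`uu' ∈ E`, `vv' ∈ E` and `uv' ∉ E`. -/
def PlusArc (E : V → V → Prop) (p q : V × V) : Prop :=
  E p.1 q.1 ∧ E p.2 q.2 ∧ ¬ E p.1 q.2

/-- A `−` arc of the pair digraph `H⁺`: from `(u,v)` to `(u',v')` when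
`u'u ∈ E`, `v'v ∈ E` and `v'u ∉ E`. -/
def MinusArc (E : V → V → Prop) (p q : V × V) : Prop :=
  E q.1 p.1 ∧ E q.2 p.2 ∧ ¬ E q.2 p.1

/-- The arc relation of the pair digraph `H⁺`. -/
def HPlusArc (E : V → V → Prop) (p q : V × V) : Prop :=
  PlusArc E p q ∨ MinusArc E p q

/-- `x 0, x 1, ..., x n` is a walk in the digraph `E` with pattern `ε`:
step `i` is a forward arc if `ε i = true` and a backward arc if `ε i = false`.
Two walks are congruent iff they have the same length `n` and the same pattern `ε`. -/
def IsWalkOn (E : V → V → Prop) (n : ℕ) (x : ℕ → V) (ε : ℕ → Bool) : Prop :=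
  ∀ i < n, if ε i = true then E (x i) (x (i + 1)) else E (x (i + 1)) (x i)

/-- The walk `x` avoids the congruent walk `y` (common pattern `ε`, length `n`):
there is no arc from `x i` to `y (i+1)` in the direction of step `i`. -/
def AvoidsOn (E : V → V → Prop) (n : ℕ) (x y : ℕ → V) (ε : ℕ → Bool) : Prop :=
  ∀ i < n, if ε i = true then ¬ E (x i) (y (i + 1)) else ¬ E (y (i + 1)) (x i)

/-- `u, v` is an invertible pair: there are congruent walks `P : u → v`, `Q : v → u`
with `P` avoiding `Q`, and congruent walks `P' : v → u`, `Q' : u → v` with `P'`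
avoiding `Q'`. -/
def InvertiblePair (E : V → V → Prop) (u v : V) : Prop :=
  (∃ (n : ℕ) (x y : ℕ → V) (ε : ℕ → Bool),
      IsWalkOn E n x ε ∧ IsWalkOn E n y ε ∧
      x 0 = u ∧ x n = v ∧ y 0 = v ∧ y n = u ∧ AvoidsOn E n x y ε) ∧
  (∃ (n : ℕ) (x y : ℕ → V) (ε : ℕ → Bool),
      IsWalkOn E n x ε ∧ IsWalkOn E n y ε ∧
      x 0 = v ∧ x n = u ∧ y 0 = u ∧ y n = v ∧ AvoidsOn E n x y ε)

theorem hplus_skew (E : V → V → Prop) {a b : V × V} (h : HPlusArc E a b) :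
    HPlusArc E b.swap a.swap := by
  rcases h with ⟨h1, h2, h3⟩ | ⟨h1, h2, h3⟩
  · exact Or.inr ⟨h2, h1, h3⟩
  · exact Or.inl ⟨h2, h1, h3⟩

theorem reach_skew (E : V → V → Prop) {a b : V × V}
    (h : Relation.ReflTransGen (HPlusArc E) a b) :
    Relation.ReflTransGen (HPlusArc E) b.swap a.swap := by
  induction h with
  | refl => exact Relation.ReflTransGen.refl
  | tail _ hbc ih => exact Relation.ReflTransGen.head (hplus_skew E hbc) ih

theorem reach_of_walks (E : V → V → Prop) (n : ℕ) (x y : ℕ → V) (ε : ℕ → Bool)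
    (hx : IsWalkOn E n x ε) (hy : IsWalkOn E n y ε) (ha : AvoidsOn E n x y ε) :
    Relation.ReflTransGen (HPlusArc E) (x 0, y 0) (x n, y n) := by
  induction n with
  | zero => exact Relation.ReflTransGen.refl
  | succ n ih =>
    refine Relation.ReflTransGen.tail (ih (fun i hi => hx i (by omega))
      (fun i hi => hy i (by omega)) (fun i hi => ha i (by omega))) ?_
    have h1 := hx n (by omega)
    have h2 := hy n (by omega)
    have h3 := ha n (by omega)
    by_cases he : ε n = true
    · rw [if_pos he] at h1 h2 h3
      exact Or.inl ⟨h1, h2, h3⟩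
    · rw [if_neg he] at h1 h2 h3
      exact Or.inr ⟨h1, h2, h3⟩

theorem walks_of_reach (E : V → V → Prop) {a b : V × V}
    (h : Relation.ReflTransGen (HPlusArc E) a b) :
    ∃ (n : ℕ) (x y : ℕ → V) (ε : ℕ → Bool),
      IsWalkOn E n x ε ∧ IsWalkOn E n y ε ∧
      x 0 = a.1 ∧ x n = b.1 ∧ y 0 = a.2 ∧ y n = b.2 ∧ AvoidsOn E n x y ε := by
  induction h using Relation.ReflTransGen.head_induction_on with
  | refl =>
    exact ⟨0, fun _ => b.1, fun _ => b.2, fun _ => true, fun i hi => by omega,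
      fun i hi => by omega, rfl, rfl, rfl, rfl, fun i hi => by omega⟩
  | @head a c hac _ ih =>
    obtain ⟨n, x, y, ε, hx, hy, x0, xn, y0, yn, ha⟩ := ih
    have key : ∃ s : Bool, (if s = true then E a.1 c.1 else E c.1 a.1) ∧
        (if s = true then E a.2 c.2 else E c.2 a.2) ∧
        (if s = true then ¬ E a.1 c.2 else ¬ E c.2 a.1) := by
      rcases hac with h | h
      · exact ⟨true, by simpa [PlusArc] using h⟩
      · exact ⟨false, by simpa [MinusArc] using h⟩
    obtain ⟨s, h1, h2, h3⟩ := key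
    rw [← x0] at h1
    rw [← y0] at h2 h3
    refine ⟨n + 1, fun i => Nat.casesOn i a.1 x, fun i => Nat.casesOn i a.2 y,
      fun i => Nat.casesOn i s ε, ?_, ?_, rfl, xn, rfl, yn, ?_⟩
    · rintro (_ | i) hi
      · exact h1
      · exact hx i (by omega)
    · rintro (_ | i) hi
      · exact h2
      · exact hy i (by omega)
    · rintro (_ | i) hi
      · exact h3
      · exact ha i (by omega)

/-- If `u, v` is an invertible pair in `H` and `(p,q)` lies in the same strong component
of `H⁺` as `(u,v)`, then `p, q` is also an invertible pair in `H`. -/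
theorem invertible_of_same_scc (E : V → V → Prop) (u v p q : V)
    (h : InvertiblePair E u v)
    (h₁ : Relation.ReflTransGen (HPlusArc E) (u, v) (p, q))
    (h₂ : Relation.ReflTransGen (HPlusArc E) (p, q) (u, v)) :
    InvertiblePair E p q := by
  obtain ⟨⟨n, x, y, ε, hx, hy, x0, xn, y0, yn, ha⟩,
    ⟨m, x', y', ε', hx', hy', x0', xm', y0', ym', ha'⟩⟩ := h
  have r := reach_of_walks E n x y ε hx hy ha
  have r' := reach_of_walks E m x' y' ε' hx' hy' ha'
  rw [x0, xn, y0, yn] at r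
  rw [x0', xm', y0', ym'] at r'
  exact ⟨walks_of_reach E ((h₂.trans r).trans (reach_skew E h₂)),
    walks_of_reach E (((reach_skew E h₁).trans r').trans h₁)⟩
end

section
/- Let H be a digraph. If there is a directed walk in H^+ from (x,y) to a special vertex (x',y'), then (x,y) is special. -/
variable {V : Type*}

/-- A vertex `(x,y)` of `H⁺` is special if there is a directed walk in `H⁺`
from `(x,y)` to `(y,x)`. -/
def SpecialVertex (E : V → V → Prop) (p : V × V) : Prop :=
  Relation.ReflTransGen (HPlusArc E) p (p.2, p.1)

/-- Skew symmetry of the pair digraph: reversing an arc and swapping coordinates. -/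
theorem hPlusArc_swap (E : V → V → Prop) (p q : V × V) (h : HPlusArc E p q) :
    HPlusArc E q.swap p.swap := by
  rcases h with ⟨h1, h2, h3⟩ | ⟨h1, h2, h3⟩
  · exact Or.inr ⟨h2, h1, h3⟩
  · exact Or.inl ⟨h2, h1, h3⟩

theorem reach_swap (E : V → V → Prop) (p q : V × V)
    (h : Relation.ReflTransGen (HPlusArc E) p q) :
    Relation.ReflTransGen (HPlusArc E) q.swap p.swap := by
  induction h with
  | refl => exact Relation.ReflTransGen.refl
  | tail _ hbc ih => exact Relation.ReflTransGen.head (hPlusArc_swap E _ _ hbc) ih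

/-- If there is a directed walk in `H⁺` from `(x,y)` to a special vertex `(x',y')`,
then `(x,y)` is special. -/
theorem special_of_reaches_special (E : V → V → Prop) (x y x' y' : V)
    (hreach : Relation.ReflTransGen (HPlusArc E) (x, y) (x', y'))
    (hsp : SpecialVertex E (x', y')) :
    SpecialVertex E (x, y) := by
  exact (hreach.trans hsp).trans (reach_swap E _ _ hreach)
end

section
/- Let H be a digraph and let C_1 and C_2 be self-coupled strong components of H^+. If some vertex of C_2 is reachable in H^+ from some vertex of C_1, then C_1 = C_2. (Equivalently, any directed path in the condensation of H^+ passes through at most one self-coupled strong component.) -/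
variable {V : Type*}

/-- Two vertices lie in the same strong component: each is reachable from the other. -/
def InSameSCC {α : Type*} (R : α → α → Prop) (a b : α) : Prop :=
  Relation.ReflTransGen R a b ∧ Relation.ReflTransGen R b a

/-- `C` is a strong component of the digraph with arc relation `R`. -/
def IsSCC {α : Type*} (R : α → α → Prop) (C : Set α) : Prop :=
  ∃ a, C = {b | InSameSCC R a b}

theorem hplus_swap (E : V → V → Prop) {p q : V × V} (h : HPlusArc E p q) :
    HPlusArc E q.swap p.swap := by
  rcases h with ⟨a, b, c⟩ | ⟨a, b, c⟩
  · exact Or.inr ⟨b, a, c⟩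
  · exact Or.inl ⟨b, a, c⟩

theorem hplus_reach_swap (E : V → V → Prop) {p q : V × V}
    (h : Relation.ReflTransGen (HPlusArc E) p q) :
    Relation.ReflTransGen (HPlusArc E) q.swap p.swap := by
  induction h with
  | refl => exact .refl
  | tail _ hbc ih => exact .head (hplus_swap E hbc) ih

/-- Any two self-coupled strong components of `H⁺`, one reachable from the other,
coincide: a directed path in the condensation of `H⁺` meets at most one self-coupled
strong component. -/
theorem self_coupled_unique_on_path (E : V → V → Prop) (C₁ C₂ : Set (V × V))
    (h₁ : IsSCC (HPlusArc E) C₁) (h₂ : IsSCC (HPlusArc E) C₂)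
    (hs₁ : C₁ = {p | (p.2, p.1) ∈ C₁}) (hs₂ : C₂ = {p | (p.2, p.1) ∈ C₂})
    (hreach : ∃ p ∈ C₁, ∃ q ∈ C₂, Relation.ReflTransGen (HPlusArc E) p q) :
    C₁ = C₂ := by
  obtain ⟨p, hp, q, hq, hpq⟩ := hreach
  have hp' : p.swap ∈ C₁ := by rw [hs₁] at hp; exact hp
  have hq' : q.swap ∈ C₂ := by rw [hs₂] at hq; exact hq
  obtain ⟨a, rfl⟩ := h₁
  obtain ⟨b, rfl⟩ := h₂
  have hqp := hplus_reach_swap E hpq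
  have hab : Relation.ReflTransGen (HPlusArc E) a b := (hp.1.trans hpq).trans hq.2
  have hba : Relation.ReflTransGen (HPlusArc E) b a := (hq'.1.trans hqp).trans hp'.2
  ext x
  exact ⟨fun h => ⟨hba.trans h.1, h.2.trans hab⟩, fun h => ⟨hab.trans h.1, h.2.trans hba⟩⟩
end

section
/- Let H be a digraph. If H has no permutable triple, then H admits a conservative majority polymorphism, i.e., a conservative ternary polymorphism μ with μ(u,u,v) = μ(u,v,u) = μ(v,u,u) = u for all vertices u, v. -/
variable {V : Type*}

/-- The witnessing condition of a permutable triple, for the vertex `x` of the triple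
`x, y, z`: there are mutually congruent walks `P : x → sx`, `Q : y → bx`, `R : z → bx`
such that `P` avoids both `Q` and `R`. -/
def TripleWitness (E : V → V → Prop) (x y z sx bx : V) : Prop :=
  ∃ (n : ℕ) (ε : ℕ → Bool) (P Q R : ℕ → V),
    IsWalkOn E n P ε ∧ IsWalkOn E n Q ε ∧ IsWalkOn E n R ε ∧
    P 0 = x ∧ P n = sx ∧ Q 0 = y ∧ Q n = bx ∧ R 0 = z ∧ R n = bx ∧
    AvoidsOn E n P Q ε ∧ AvoidsOn E n P R ε

/-- `u, v, w` (distinct) form a permutable triple with witnesses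
`su, bu, sv, bv, sw, bw`. -/
def PermutableWitnesses (E : V → V → Prop) (u v w su bu sv bv sw bw : V) : Prop :=
  u ≠ v ∧ u ≠ w ∧ v ≠ w ∧
  TripleWitness E u v w su bu ∧ TripleWitness E v u w sv bv ∧ TripleWitness E w u v sw bw

/-- `H` has a permutable triple. -/
def HasPermutableTriple (E : V → V → Prop) : Prop :=
  ∃ u v w su bu sv bv sw bw : V, PermutableWitnesses E u v w su bu sv bv sw bw

/-- A digraph asteroidal triple (DAT): a permutable triple in which each of the
three pairs `(su,bu)`, `(sv,bv)`, `(sw,bw)` is invertible. -/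
def IsDAT (E : V → V → Prop) (u v w su bu sv bv sw bw : V) : Prop :=
  PermutableWitnesses E u v w su bu sv bv sw bw ∧
  InvertiblePair E su bu ∧ InvertiblePair E sv bv ∧ InvertiblePair E sw bw

/-- `H` is DAT-free. -/
def DATFree (E : V → V → Prop) : Prop :=
  ¬ ∃ u v w su bu sv bv sw bw : V, IsDAT E u v w su bu sv bv sw bw

/-- `f` is a binary polymorphism of the digraph `E`. -/
def BinPoly (E : V → V → Prop) (f : V → V → V) : Prop :=
  ∀ a b a' b', E a a' → E b b' → E (f a b) (f a' b')

/-- A binary operation is conservative. -/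
def BinConservative (f : V → V → V) : Prop :=
  ∀ a b, f a b = a ∨ f a b = b

/-- `g` is a ternary polymorphism of the digraph `E`. -/
def TerPoly (E : V → V → Prop) (g : V → V → V → V) : Prop :=
  ∀ a b c a' b' c', E a a' → E b b' → E c c' → E (g a b c) (g a' b' c')

/-- A ternary operation is conservative. -/
def TerConservative (g : V → V → V → V) : Prop :=
  ∀ a b c, g a b c = a ∨ g a b c = b ∨ g a b c = c

/-- `x` can be distinguished from `y` and `z`. -/
def Dist3 (E : V → V → Prop) (x y z : V) : Prop :=
  x ≠ y ∧ x ≠ z ∧ ∃ s b, TripleWitness E x y z s b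

theorem TripleWitness.symm' {E : V → V → Prop} {x y z s b : V}
    (h : TripleWitness E x y z s b) : TripleWitness E x z y s b := by
  obtain ⟨n, ε, P, Q, R, h1, h2, h3, h4, h5, h6, h7, h8, h9, h10, h11⟩ := h
  exact ⟨n, ε, P, R, Q, h1, h3, h2, h4, h5, h8, h9, h6, h7, h11, h10⟩

theorem Dist3.symm' {E : V → V → Prop} {x y z : V} (h : Dist3 E x y z) : Dist3 E x z y := by
  obtain ⟨h1, h2, s, b, h3⟩ := h
  exact ⟨h2, h1, s, b, h3.symm'⟩

theorem TripleWitness.base (E : V → V → Prop) (x y : V) : TripleWitness E x y y x y :=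
  ⟨0, fun _ => true, fun _ => x, fun _ => y, fun _ => y,
    by simp [IsWalkOn, AvoidsOn]⟩

theorem isWalkOn_cons {E : V → V → Prop} {n : ℕ} {P : ℕ → V} {ε : ℕ → Bool} {e : Bool} {x : V}
    (h : IsWalkOn E n P ε) (h0 : if e = true then E x (P 0) else E (P 0) x) :
    IsWalkOn E (n + 1) (fun i => Nat.casesOn i x P) (fun i => Nat.casesOn i e ε) := by
  intro i hi
  cases i with
  | zero => exact h0
  | succ i => exact h i (by omega)

theorem avoidsOn_cons {E : V → V → Prop} {n : ℕ} {P Q : ℕ → V} {ε : ℕ → Bool} {e : Bool}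
    {x y : V}
    (h : AvoidsOn E n P Q ε) (h0 : if e = true then ¬ E x (Q 0) else ¬ E (Q 0) x) :
    AvoidsOn E (n + 1) (fun i => Nat.casesOn i x P) (fun i => Nat.casesOn i y Q)
      (fun i => Nat.casesOn i e ε) := by
  intro i hi
  cases i with
  | zero => exact h0
  | succ i => exact h i (by omega)

theorem TripleWitness.cons {E : V → V → Prop} {x y z x' y' z' s b : V} (e : Bool)
    (h : TripleWitness E x' y' z' s b)
    (hx : if e = true then E x x' else E x' x)
    (hy : if e = true then E y y' else E y' y)
    (hz : if e = true then E z z' else E z' z)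
    (hxy : if e = true then ¬ E x y' else ¬ E y' x)
    (hxz : if e = true then ¬ E x z' else ¬ E z' x) : TripleWitness E x y z s b := by
  obtain ⟨n, ε, P, Q, R, h1, h2, h3, rfl, h5, rfl, h7, rfl, h9, h10, h11⟩ := h
  exact ⟨n + 1, fun i => Nat.casesOn i e ε, fun i => Nat.casesOn i x P,
    fun i => Nat.casesOn i y Q, fun i => Nat.casesOn i z R,
    isWalkOn_cons h1 hx, isWalkOn_cons h2 hy, isWalkOn_cons h3 hz, rfl, h5, rfl, h7, rfl, h9,
    avoidsOn_cons h10 hxy, avoidsOn_cons h11 hxz⟩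

theorem Dist3.fwd {E : V → V → Prop} {x y z x' y' z' s b : V}
    (h : TripleWitness E x' y' z' s b) (hx : E x x') (hy : E y y') (hz : E z z')
    (hxy : ¬ E x y') (hxz : ¬ E x z') : Dist3 E x y z :=
  ⟨fun e => hxy (e ▸ hy), fun e => hxz (e ▸ hz), s, b, h.cons true hx hy hz hxy hxz⟩

theorem Dist3.bwd {E : V → V → Prop} {x y z x' y' z' s b : V}
    (h : TripleWitness E x' y' z' s b) (hx : E x' x) (hy : E y' y) (hz : E z' z)
    (hxy : ¬ E y' x) (hxz : ¬ E z' x) : Dist3 E x y z :=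
  ⟨fun e => hxy (e ▸ hy), fun e => hxz (e ▸ hz), s, b,
    h.cons false (by simpa) (by simpa) (by simpa) (by simpa) (by simpa)⟩

theorem Dist3.core {E : V → V → Prop} {a b c a' b' c' : V}
    (ha : E a a') (hb : E b b') (hc : E c c')
    (h1 : ¬ Dist3 E a b c) (h2 : ¬ Dist3 E b' a' c') (h : ¬ E a b') :
    ¬ Dist3 E b a c ∧ ¬ Dist3 E a' b' c' := by
  have hac : ¬ E a c' := fun hac =>
    h2 (Dist3.bwd (TripleWitness.base E b a) hb ha hac h h)
  have hcb : ¬ E c b' := fun hcb =>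
    h1 (Dist3.fwd (TripleWitness.base E a' b') ha hb hcb h h)
  constructor
  · rintro ⟨-, -, s, t, hw⟩
    exact h2 (Dist3.bwd hw hb ha hc h hcb)
  · rintro ⟨-, -, s, t, hw⟩
    exact h1 (Dist3.fwd hw ha hb hc h hac)

theorem not_dist3_self (E : V → V → Prop) (a b : V) :
    ¬ Dist3 E a a b ∧ ¬ Dist3 E a b a :=
  ⟨fun h => h.1 rfl, fun h => h.2.1 rfl⟩

open Classical in
/-- The majority operation: the first vertex which cannot be distinguished. -/
noncomputable def maj3 (E : V → V → Prop) (a b c : V) : V :=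
  if ¬ Dist3 E a b c then a else if ¬ Dist3 E b a c then b else c

theorem maj3_cases {E : V → V → Prop} (h : ¬ HasPermutableTriple E) (a b c : V) :
    (maj3 E a b c = a ∧ ¬ Dist3 E a b c) ∨
    (maj3 E a b c = b ∧ Dist3 E a b c ∧ ¬ Dist3 E b a c) ∨
    (maj3 E a b c = c ∧ Dist3 E a b c ∧ Dist3 E b a c ∧ ¬ Dist3 E c a b) := by
  by_cases h1 : Dist3 E a b c
  · by_cases h2 : Dist3 E b a c
    · refine Or.inr (Or.inr ⟨by simp [maj3, h1, h2], h1, h2, ?_⟩)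
      rintro ⟨-, -, s3, b3, w3⟩
      obtain ⟨n1, n2, s1, b1, w1⟩ := h1
      obtain ⟨-, n3, s2, b2, w2⟩ := h2
      exact h ⟨a, b, c, s1, b1, s2, b2, s3, b3, n1, n2, n3, w1, w2, w3⟩
    · exact Or.inr (Or.inl ⟨by simp [maj3, h1, h2], h1, h2⟩)
  · exact Or.inl ⟨by simp [maj3, h1], h1⟩

/-- If a digraph has no permutable triple, then it admits a conservative majority
polymorphism. -/
theorem majority_of_no_permutable_triple (E : V → V → Prop)
    (h : ¬ HasPermutableTriple E) :
    ∃ g : V → V → V → V, TerPoly E g ∧ TerConservative g ∧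
      ∀ a b : V, g a a b = a ∧ g a b a = a ∧ g b a a = a := by
  refine ⟨maj3 E, ?_, ?_, ?_⟩
  · intro a b c a' b' c' ha hb hc
    by_contra hn
    rcases maj3_cases h a b c with ⟨e, p⟩ | ⟨e, p1, p⟩ | ⟨e, p1, p2, p⟩ <;>
    rcases maj3_cases h a' b' c' with ⟨e', q⟩ | ⟨e', q1, q⟩ | ⟨e', q1, q2, q⟩ <;>
    rw [e, e'] at hn
    · exact hn ha
    · exact (Dist3.core ha hb hc p q hn).2 q1
    · exact (Dist3.core ha hc hb (mt Dist3.symm' p) q hn).2 q1.symm'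
    · exact (Dist3.core hb ha hc p q hn).1 p1
    · exact hn hb
    · exact (Dist3.core hb hc ha (mt Dist3.symm' p) (mt Dist3.symm' q) hn).2 q2.symm'
    · exact (Dist3.core hc ha hb p (mt Dist3.symm' q) hn).1 p1.symm'
    · exact (Dist3.core hc hb ha (mt Dist3.symm' p) (mt Dist3.symm' q) hn).1 p2.symm'
    · exact hn hc
  · intro a b c
    rcases maj3_cases h a b c with ⟨e, -⟩ | ⟨e, -⟩ | ⟨e, -⟩ <;> simp [e]
  · intro a b
    refine ⟨?_, ?_, ?_⟩
    · simp [maj3, not_dist3_self]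
    · simp [maj3, not_dist3_self]
    · by_cases hab : a = b
      · subst hab
        simp [maj3, not_dist3_self]
      · have hd : Dist3 E b a a :=
          ⟨fun e => hab e.symm, fun e => hab e.symm, b, a, TripleWitness.base E b a⟩
        simp [maj3, not_dist3_self, hd]
end

section
/- Let H be a digraph. If H admits a conservative majority polymorphism (a conservative ternary polymorphism μ with μ(u,u,v) = μ(u,v,u) = μ(v,u,u) = u for all vertices u, v), then H has no permutable triple. -/
variable {V : Type*}

/-- Along walks witnessing a triple, a conservative majority operation cannot pick
the avoiding coordinate. -/
theorem TripleWitness.majority_ne {V : Type*} (E : V → V → Prop)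
    (g : V → V → V → V) (hpoly : TerPoly E g) (hcons : TerConservative g)
    (hmaj : ∀ a b : V, g b a a = a) {x y z s b : V} (hyz : y ≠ z)
    (h : TripleWitness E x y z s b) : g x y z ≠ x := by
  obtain ⟨n, ε, P, Q, R, hP, hQ, hR, P0, Pn, Q0, Qn, R0, Rn, aQ, aR⟩ := h
  intro hx
  have key : ∀ i ≤ n, g (P i) (Q i) (R i) = P i := by
    intro i
    induction i with
    | zero => intro _; rw [P0, Q0, R0]; exact hx
    | succ i ih =>
      intro hi
      have hi' : i < n := hi
      have e := ih hi'.le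
      have h1 := hP i hi'
      have h2 := hQ i hi'
      have h3 := hR i hi'
      have h4 := aQ i hi'
      have h5 := aR i hi'
      by_cases hε : ε i = true
      · simp only [hε, if_true] at h1 h2 h3 h4 h5
        have h6 := hpoly _ _ _ _ _ _ h1 h2 h3
        rw [e] at h6
        rcases hcons (P (i+1)) (Q (i+1)) (R (i+1)) with c | c | c
        · exact c
        · rw [c] at h6; exact absurd h6 h4
        · rw [c] at h6; exact absurd h6 h5
      · simp only [hε] at h1 h2 h3 h4 h5
        have h6 := hpoly _ _ _ _ _ _ h1 h2 h3
        rw [e] at h6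
        rcases hcons (P (i+1)) (Q (i+1)) (R (i+1)) with c | c | c
        · exact c
        · rw [c] at h6; exact absurd h6 h4
        · rw [c] at h6; exact absurd h6 h5
  have hn := key n le_rfl
  rw [Qn, Rn, hmaj] at hn
  cases n with
  | zero => exact hyz (by rw [← Q0, ← R0, Qn, Rn])
  | succ m =>
    have h1 := hP m (Nat.lt_succ_self m)
    have h4 := aQ m (Nat.lt_succ_self m)
    rw [Qn, hn] at h4
    by_cases hε : ε m = true
    · simp only [hε, if_true] at h1 h4
      exact h4 h1
    · simp only [hε] at h1 h4
      exact h4 h1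

/-- If a digraph admits a conservative majority polymorphism, then it has no
permutable triple. -/
theorem no_permutable_triple_of_majority (E : V → V → Prop)
    (g : V → V → V → V) (hpoly : TerPoly E g) (hcons : TerConservative g)
    (hmaj : ∀ a b : V, g a a b = a ∧ g a b a = a ∧ g b a a = a) :
    ¬ HasPermutableTriple E := by
  rintro ⟨u, v, w, su, bu, sv, bv, sw, bw, huv, huw, hvw, hu, hv, hw⟩
  rcases hcons u v w with c | c | c
  · exact hu.majority_ne E g hpoly hcons (fun a b => (hmaj a b).2.2) hvw c
  · refine hv.majority_ne E (fun a b c => g b a c) ?_ ?_ (fun a b => (hmaj a b).2.1) huw c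
    · intro a b c a' b' c' h1 h2 h3
      exact hpoly _ _ _ _ _ _ h2 h1 h3
    · intro a b c
      rcases hcons b a c with h | h | h <;> simp [h]
  · refine hw.majority_ne E (fun a b c => g b c a) ?_ ?_ (fun a b => (hmaj a b).1) huv c
    · intro a b c a' b' c' h1 h2 h3
      exact hpoly _ _ _ _ _ _ h2 h3 h1
    · intro a b c
      rcases hcons b c a with h | h | h <;> simp [h]
end

section
/- Let H be a digraph and let f be a conservative binary polymorphism of H. If H^+ contains an arc from (x,y) to (x',y') and f(x,y) = x, then f(x',y') = x'. Equivalently, if f(x',y') = y' then f(x,y) = y. -/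
variable {V : Type*}

/-- If `f` is a conservative binary polymorphism of `H` and `H⁺` has an arc from
`(x,y)` to `(x',y')`, then `f x y = x` implies `f x' y' = x'`; equivalently,
`f x' y' = y'` implies `f x y = y`. -/
theorem conservative_poly_propagates (E : V → V → Prop) (f : V → V → V)
    (hpoly : BinPoly E f) (hcons : BinConservative f) (x y x' y' : V)
    (harc : HPlusArc E (x, y) (x', y')) :
    (f x y = x → f x' y' = x') ∧ (f x' y' = y' → f x y = y) := by
  have key : ¬ (f x y = x ∧ f x' y' = y') := by
    rintro ⟨h, h'⟩
    rcases harc with ⟨h1, h2, h3⟩ | ⟨h1, h2, h3⟩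
    · have := hpoly _ _ _ _ h1 h2
      simp only [h, h'] at this
      exact h3 this
    · have := hpoly _ _ _ _ h1 h2
      simp only [h, h'] at this
      exact h3 this
  refine ⟨fun h => ?_, fun h => ?_⟩
  · exact (hcons x' y').resolve_right fun h' => key ⟨h, h'⟩
  · exact (hcons x y).resolve_left fun h' => key ⟨h', h⟩
end

section
/- Let H be a DAT-free digraph. Then H admits a conservative ternary polymorphism g such that for every invertible pair u, v of H, the restriction of g to {u,v} is a majority, i.e., g(a,a,b) = g(a,b,a) = g(b,a,a) = a for all a, b ∈ {u,v}. -/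
variable {V : Type*}

namespace DATProof

/-- One step of a walk in direction `ε`. -/
def S (E : V → V → Prop) (ε : Bool) (u v : V) : Prop :=
  if ε = true then E u v else E v u

theorem S_not (E : V → V → Prop) (ε : Bool) (u v : V) : S E (!ε) u v ↔ S E ε v u := by
  cases ε <;> simp [S]

/-- Arcs of the pair digraph. -/
def PA (E : V → V → Prop) (p q : V × V) : Prop :=
  ∃ ε, S E ε p.1 q.1 ∧ S E ε p.2 q.2 ∧ ¬ S E ε p.1 q.2

/-- Reachability in the pair digraph. -/
def Reach (E : V → V → Prop) : V × V → V × V → Prop := Relation.ReflTransGen (PA E)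

/-- Proper invertible pairs. -/
def Inv (E : V → V → Prop) (u v : V) : Prop :=
  u ≠ v ∧ Reach E (u, v) (v, u) ∧ Reach E (v, u) (u, v)

theorem Inv.symm {E : V → V → Prop} {u v : V} (h : Inv E u v) : Inv E v u :=
  ⟨h.1.symm, h.2.2, h.2.1⟩

/-- `p` is distinguished in the triple `p, q, r`. -/
inductive Dist (E : V → V → Prop) : V → V → V → Prop
  | base {s b : V} : Inv E s b → Dist E s b b
  | step {p q r p' q' r' : V} (ε : Bool) : S E ε p p' → S E ε q q' → S E ε r r' →
      ¬ S E ε p q' → ¬ S E ε p r' → Dist E p' q' r' → Dist E p q r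

/-- The pair `u, v` reaches an invertible pair. -/
def R (E : V → V → Prop) (u v : V) : Prop := Dist E u v v

theorem Dist.swap {E : V → V → Prop} {p q r : V} (h : Dist E p q r) : Dist E p r q := by
  induction h with
  | base h => exact .base h
  | step ε a b c d e _ ih => exact .step ε a c b e d ih

theorem Dist.toR {E : V → V → Prop} {p q r : V} (h : Dist E p q r) : R E p q := by
  induction h with
  | base h => exact .base h
  | step ε a b c d e _ ih => exact .step ε a b b d d ih

theorem Dist.ne {E : V → V → Prop} {p q r : V} (h : Dist E p q r) : p ≠ q := by
  cases h with
  | base h => exact h.1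
  | step ε a b c d e _ => rintro rfl; exact d b

theorem R.reach {E : V → V → Prop} {u v : V} (h : R E u v) :
    ∃ s b, Reach E (u, v) (s, b) ∧ Inv E s b := by
  have key : ∀ p q r, Dist E p q r → ∃ s b, Reach E (p, q) (s, b) ∧ Inv E s b := by
    intro p q r h
    induction h with
    | base h => exact ⟨_, _, .refl, h⟩
    | step ε a b c d e _ ih =>
      obtain ⟨s, t, h1, h2⟩ := ih
      exact ⟨s, t, .head ⟨ε, a, b, d⟩ h1, h2⟩
  exact key _ _ _ h

theorem PA_skew {E : V → V → Prop} {p q : V × V} (h : PA E p q) : PA E q.swap p.swap := by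
  obtain ⟨ε, a, b, c⟩ := h
  exact ⟨!ε, by simpa [S_not] using b, by simpa [S_not] using a, by simpa [S_not] using c⟩

theorem Reach_skew {E : V → V → Prop} {p q : V × V} (h : Reach E p q) :
    Reach E q.swap p.swap := by
  induction h with
  | refl => exact .refl
  | tail _ h ih => exact .head (PA_skew h) ih

theorem R_pred {E : V → V → Prop} {p q : V × V} (h : PA E p q) (hq : R E q.1 q.2) :
    R E p.1 p.2 := by
  obtain ⟨ε, a, b, c⟩ := h
  exact .step ε a b b c c hq

theorem R_flip {E : V → V → Prop} {u v : V} (h : R E u v) : Reach E (u, v) (v, u) := by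
  obtain ⟨s, b, h1, h2⟩ := h.reach
  exact (h1.trans h2.2.1).trans (Reach_skew h1)

theorem R_both {E : V → V → Prop} {u v : V} (h : R E u v) (h' : R E v u) : Inv E u v :=
  ⟨h.ne, R_flip h, R_flip h'⟩

/-- Properties of the preference relation. -/
structure Pref (E : V → V → Prop) (T : Set (V × V)) : Prop where
  sub : ∀ u v, R E u v → (u, v) ∈ T
  pred : ∀ p q, PA E p q → q ∈ T → p ∈ T
  anti : ∀ u v, (u, v) ∈ T → (v, u) ∈ T → u ≠ v → Inv E u v

theorem Pref.reach {E : V → V → Prop} {T : Set (V × V)} (h : Pref E T) {p q : V × V}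
    (hr : Reach E p q) (hq : q ∈ T) : p ∈ T := by
  induction hr with
  | refl => exact hq
  | tail _ h1 ih => exact ih (h.pred _ _ h1 hq)

theorem exists_pref (E : V → V → Prop) :
    ∃ T : Set (V × V), Pref E T ∧ ∀ u v, u ≠ v → (u, v) ∈ T ∨ (v, u) ∈ T := by
  have h0 : Pref E {p | R E p.1 p.2} :=
    ⟨fun _ _ h => h, fun _ _ h hq => R_pred h hq, fun _ _ h h' _ => R_both h h'⟩
  obtain ⟨T, -, hT⟩ := zorn_subset_nonempty {T | Pref E T} (by
    intro c hc hch hne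
    refine ⟨⋃₀ c, ⟨?_, ?_, ?_⟩, fun s hs => Set.subset_sUnion_of_mem hs⟩
    · intro u v h
      obtain ⟨s, hs⟩ := hne
      exact ⟨s, hs, (hc hs).sub u v h⟩
    · rintro p q h ⟨s, hs, hq⟩
      exact ⟨s, hs, (hc hs).pred p q h hq⟩
    · rintro u v ⟨s, hs, h1⟩ ⟨t, ht, h2⟩ hne'
      rcases hch.total hs ht with h | h
      · exact (hc ht).anti u v (h h1) h2 hne'
      · exact (hc hs).anti u v h1 (h h2) hne') _ h0
  refine ⟨T, hT.prop, ?_⟩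
  intro u v huv
  by_contra hcon
  push Not at hcon
  obtain ⟨hn1, hn2⟩ := hcon
  have key : ∀ u v, (u, v) ∉ T → (v, u) ∉ T → Reach E (v, u) (u, v) := by
    intro u v hn1 hn2
    by_contra hr
    have hP : Pref E (T ∪ {p | Reach E p (u, v)}) := by
      refine ⟨fun a b h => Or.inl (hT.prop.sub a b h), ?_, ?_⟩
      · rintro p q h (hq | hq)
        · exact Or.inl (hT.prop.pred p q h hq)
        · exact Or.inr (Relation.ReflTransGen.head h hq)
      · rintro a b (h1 | h1) (h2 | h2) hne
        · exact hT.prop.anti a b h1 h2 hne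
        · exact absurd (hT.prop.reach (Reach_skew h2) h1) hn2
        · exact absurd (hT.prop.reach (Reach_skew h1) h2) hn2
        · exact absurd ((Reach_skew h2).trans h1) hr
    exact hn1 (hT.le_of_ge hP Set.subset_union_left (Or.inr .refl))
  exact hn1 (hT.prop.sub u v (.base ⟨huv, key v u hn2 hn1, key u v hn1 hn2⟩))

/-- Coordinate `i` of the triple `x` is distinguished. -/
def D (E : V → V → Prop) (x : Fin 3 → V) (i : Fin 3) : Prop :=
  ∃ j k, i ≠ j ∧ i ≠ k ∧ j ≠ k ∧ Dist E (x i) (x j) (x k)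

theorem D_iff {E : V → V → Prop} {x : Fin 3 → V} {i j k : Fin 3} (hij : i ≠ j) (hik : i ≠ k)
    (hjk : j ≠ k) : D E x i ↔ Dist E (x i) (x j) (x k) := by
  constructor
  · rintro ⟨j', k', h1, h2, h3, h⟩
    have : (j' = j ∧ k' = k) ∨ (j' = k ∧ k' = j) := by omega
    rcases this with ⟨rfl, rfl⟩ | ⟨rfl, rfl⟩
    · exact h
    · exact h.swap
  · intro h
    exact ⟨j, k, hij, hik, hjk, h⟩

theorem third (i j : Fin 3) (h : i ≠ j) : ∃ k, i ≠ k ∧ j ≠ k := by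
  revert i j; decide

theorem D_R {E : V → V → Prop} {x : Fin 3 → V} {i j : Fin 3} (hij : i ≠ j)
    (h : D E x i) : R E (x i) (x j) := by
  obtain ⟨k, h1, h2⟩ := third i j hij
  exact ((D_iff hij h1 h2).1 h).toR

/-- Strict preference for the second vertex. -/
def Lt (T : Set (V × V)) (u v : V) : Prop := (u, v) ∈ T ∧ (v, u) ∉ T

/-- Maximal undistinguished coordinates. -/
def M (E : V → V → Prop) (T : Set (V × V)) (x : Fin 3 → V) (i : Fin 3) : Prop :=
  ¬ D E x i ∧ ∀ m, ¬ D E x m → ¬ Lt T (x i) (x m)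

section
variable {E : V → V → Prop} {T : Set (V × V)} {x y : Fin 3 → V} {ε : Bool}

theorem lemF (hP : Pref E T) (hxy : ∀ t, S E ε (x t) (y t)) {i j : Fin 3}
    (hij : i ≠ j) (hn : ¬ S E ε (x i) (y j)) (hi : ¬ D E x i) (hi' : D E y i)
    (hj : ¬ D E y j) : ¬ D E x j ∧ Lt T (x i) (x j) := by
  obtain ⟨k, hik, hjk⟩ := third i j hij
  rw [D_iff hij hik hjk] at hi hi'
  rw [D_iff hij.symm hjk hik] at hj
  rw [D_iff hij.symm hjk hik]
  have h1 : S E ε (x i) (y k) := by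
    by_contra h
    exact hi (.step ε (hxy i) (hxy j) (hxy k) hn h hi')
  have h2 : ¬ S E ε (x k) (y j) := by
    intro h
    exact hi (.step ε (hxy i) (hxy j) h hn hn hi'.toR)
  have h3 : R E (x i) (x j) := .step ε (hxy i) (hxy j) (hxy j) hn hn hi'.toR
  have h4 : ¬ R E (x j) (x i) := by
    intro h
    refine hj (.step (!ε) (p' := x j) (q' := x i) (r' := x i) ?_ ?_ ?_ ?_ ?_ h) <;>
      simp only [S_not]
    exacts [hxy j, hxy i, h1, hn, hn]
  refine ⟨?_, hP.sub _ _ h3, ?_⟩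
  · intro h
    refine hj (.step (!ε) (p' := x j) (q' := x i) (r' := x k) ?_ ?_ ?_ ?_ ?_ h) <;>
      simp only [S_not]
    exacts [hxy j, hxy i, hxy k, hn, h2]
  · intro h
    exact h4 (.base (hP.anti _ _ (hP.sub _ _ h3) h h3.ne).symm)

theorem T_step (hP : Pref E T) (hxy : ∀ t, S E ε (x t) (y t)) {i j : Fin 3}
    (hn : ¬ S E ε (x i) (y j)) (h : (y i, y j) ∈ T) : (x i, x j) ∈ T :=
  hP.pred _ (y i, y j) ⟨ε, hxy i, hxy j, hn⟩ h

theorem T_step' (hP : Pref E T) (hxy : ∀ t, S E ε (x t) (y t)) {i j : Fin 3}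
    (hn : ¬ S E ε (x i) (y j)) (h : (x j, x i) ∈ T) : (y j, y i) ∈ T :=
  hP.pred _ (x j, x i) (PA_skew (p := (x i, x j)) (q := (y i, y j)) ⟨ε, hxy i, hxy j, hn⟩) h

theorem rev (hxy : ∀ t, S E ε (x t) (y t)) : ∀ t, S E (!ε) (y t) (x t) := by
  intro t; rw [S_not]; exact hxy t

theorem lemB (hP : Pref E T) (htot : ∀ u v, u ≠ v → (u, v) ∈ T ∨ (v, u) ∈ T)
    (hxy : ∀ t, S E ε (x t) (y t)) {i j : Fin 3}
    (hn : ¬ S E ε (x i) (y j)) (hi : M E T x i) (hj : M E T y j) : M E T y i := by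
  have hij : i ≠ j := by rintro rfl; exact hn (hxy i)
  have hn' : ¬ S E (!ε) (y j) (x i) := by rwa [S_not]
  have hiy : ¬ D E y i := by
    intro h
    have := lemF hP hxy hij hn hi.1 h hj.1
    exact hi.2 j this.1 this.2
  have hjx : ¬ D E x j := by
    intro h
    have := lemF hP (rev hxy) hij.symm hn' hj.1 h hi.1
    exact hj.2 i this.1 this.2
  have hne : x i ≠ x j := by
    intro h; rw [h] at hn; exact hn (hxy j)
  have c1 : (x i, x j) ∈ T → (x j, x i) ∈ T := fun h => by
    by_contra h'; exact hi.2 j hjx ⟨h, h'⟩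
  have c2 : (y j, y i) ∈ T → (y i, y j) ∈ T := fun h => by
    by_contra h'; exact hj.2 i hiy ⟨h, h'⟩
  have hji : (x j, x i) ∈ T := (htot _ _ hne).elim c1 id
  have hyji : (y j, y i) ∈ T := T_step' hP hxy hn hji
  have hxij : (x i, x j) ∈ T := T_step hP hxy hn (c2 hyji)
  have hinv : Inv E (x i) (x j) := hP.anti _ _ hxij hji hne
  refine ⟨hiy, ?_⟩
  intro k hk hlt
  have hjk : j ≠ k := by rintro rfl; exact hlt.2 hyji
  have hik : i ≠ k := by rintro rfl; exact hlt.2 hlt.1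
  have h1 : S E ε (x i) (y k) := by
    by_contra hc
    have hl : Lt T (x i) (x k) :=
      ⟨T_step hP hxy hc hlt.1, fun h => hlt.2 (T_step' hP hxy hc h)⟩
    have hkx : D E x k := by
      by_contra h; exact hi.2 k h hl
    have hc' : ¬ S E (!ε) (y k) (x i) := by rwa [S_not]
    have := lemF hP (rev hxy) hik.symm hc' hk hkx hi.1
    exact hlt.2 this.2.1
  apply hj.1
  rw [D_iff hij.symm hjk hik]
  refine .step (!ε) (p' := x j) (q' := x i) (r' := x i) ?_ ?_ ?_ ?_ ?_ (.base hinv.symm) <;>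
      simp only [S_not]
  exacts [hxy j, hxy i, h1, hn, hn]

theorem cyclic (hne : ∃ i, ¬ D E x i) (hM : ¬ ∃ i, M E T x i) :
    ∀ i j k : Fin 3, i ≠ j → i ≠ k → j ≠ k → Lt T (x i) (x j) →
      Lt T (x j) (x k) ∧ Lt T (x k) (x i) := by
  have h : ∀ i, ¬ D E x i → ∃ m, ¬ D E x m ∧ Lt T (x i) (x m) := by
    intro i hi
    by_contra hc
    push Not at hc
    exact hM ⟨i, hi, hc⟩
  have asy : ∀ i j, Lt T (x i) (x j) → ¬ Lt T (x j) (x i) := fun i j h h' => h.2 h'.1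
  have irr : ∀ i, ¬ Lt T (x i) (x i) := fun i h => h.2 h.1
  have cov : ∀ i j k m : Fin 3, i ≠ j → i ≠ k → j ≠ k → m = i ∨ m = j ∨ m = k := by decide
  -- from any undistinguished coordinate the strict order runs around the triple
  obtain ⟨a, ha⟩ := hne
  obtain ⟨b, hb, hab⟩ := h a ha
  have nab : a ≠ b := by rintro rfl; exact irr _ hab
  obtain ⟨c, hc, hbc⟩ := h b hb
  have nbc : b ≠ c := by rintro rfl; exact irr _ hbc
  have nac : a ≠ c := by rintro rfl; exact asy _ _ hab hbc
  obtain ⟨d, hd, hcd⟩ := h c hc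
  have nda : d = a := by
    rcases cov a b c d nab nac nbc with rfl | rfl | rfl
    · rfl
    · exact absurd hcd (asy _ _ hbc)
    · exact absurd hcd (irr _)
  subst nda
  intro i j k hij hik hjk hlt
  rcases cov d b c i nab nac nbc with rfl | rfl | rfl <;>
  rcases cov _ _ _ j nab nac nbc with rfl | rfl | rfl <;>
  rcases cov _ _ _ k nab nac nbc with rfl | rfl | rfl <;>
  first
    | exact absurd rfl hij
    | exact absurd rfl hik
    | exact absurd rfl hjk
    | exact ⟨by assumption, by assumption⟩
    | exact absurd hlt (asy _ _ (by assumption))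

theorem lt_or (hne : ∃ i, ¬ D E x i)
    (hM : ¬ ∃ i, M E T x i) (i j : Fin 3) (hij : i ≠ j) (hT : (x i, x j) ∈ T) :
    Lt T (x i) (x j) := by
  -- in a cyclic triple every pair is strictly comparable
  have h : ∀ i, ¬ D E x i → ∃ m, ¬ D E x m ∧ Lt T (x i) (x m) := by
    intro i hi
    by_contra hc
    push Not at hc
    exact hM ⟨i, hi, hc⟩
  have hcyc := cyclic hne hM
  obtain ⟨a, ha⟩ := hne
  obtain ⟨b, hb, hab⟩ := h a ha
  have nab : a ≠ b := by rintro rfl; exact hab.2 hab.1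
  obtain ⟨c, nac, nbc⟩ := third a b nab
  obtain ⟨hbc, hca⟩ := hcyc a b c nab nac nbc hab
  refine ⟨hT, fun h' => ?_⟩
  have cov : ∀ i j k m : Fin 3, i ≠ j → i ≠ k → j ≠ k → m = i ∨ m = j ∨ m = k := by decide
  rcases cov a b c i nab nac nbc with rfl | rfl | rfl <;>
  rcases cov _ _ _ j nab nac nbc with rfl | rfl | rfl <;>
  first
    | exact absurd rfl hij
    | exact hab.2 h'
    | exact hab.2 hT
    | exact hbc.2 h'
    | exact hbc.2 hT
    | exact hca.2 h'
    | exact hca.2 hT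

theorem lemC (hP : Pref E T) (htot : ∀ u v, u ≠ v → (u, v) ∈ T ∨ (v, u) ∈ T)
    (hxy : ∀ t, S E ε (x t) (y t)) (hne : ∃ i, ¬ D E x i) (hM : ¬ ∃ i, M E T x i)
    {i j : Fin 3} (hj : M E T y j) : S E ε (x i) (y j) := by
  by_contra hn
  have hij : i ≠ j := by rintro rfl; exact hn (hxy i)
  have hney : y i ≠ y j := by
    intro h; rw [← h] at hn; exact hn (hxy i)
  have h1 : (y i, y j) ∈ T := by
    by_cases hi : D E y i
    · exact hP.sub _ _ (D_R hij hi)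
    · by_contra hc
      exact hj.2 i hi ⟨(htot _ _ hney).resolve_left hc, hc⟩
  have h2 : Lt T (x i) (x j) := lt_or hne hM i j hij (T_step hP hxy hn h1)
  obtain ⟨k, hik, hjk⟩ := third i j hij
  obtain ⟨h3, h4⟩ := cyclic hne hM i j k hij hik hjk h2
  by_cases hk : S E ε (x k) (y j)
  · exact h4.2 (hP.pred _ (y i, y j) ⟨ε, hxy i, hk, hn⟩ h1)
  · have h5 : (y k, y j) ∉ T := fun h => h3.2 (T_step hP hxy hk h)
    have hnek : y j ≠ y k := by
      intro h; rw [h] at hk; exact hk (hxy k)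
    have hDk : D E y k := by
      by_contra hc
      exact hj.2 k hc ⟨(htot _ _ hnek).resolve_right h5, h5⟩
    exact h5 (hP.sub _ _ (D_R hjk.symm hDk))

end

theorem exists_sel (P : Fin 3 → Prop) :
    ∃ s : Fin 3, (P s ∧ ∀ m, P m → s ≤ m) ∨ ((¬ ∃ i, P i) ∧ s = 0) := by
  classical
  by_cases h : ∃ i, P i
  · obtain ⟨s, hs⟩ := (Set.toFinite {i | P i}).exists_minimal h
    refine ⟨s, Or.inl ⟨hs.prop, fun m hm => ?_⟩⟩
    rcases le_total s m with h | h
    · exact h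
    · exact hs.le_of_le hm h
  · exact ⟨0, Or.inr ⟨h, rfl⟩⟩

theorem main (E : V → V → Prop) (hne : ∀ x : Fin 3 → V, ∃ i, ¬ D E x i) :
    ∃ s : (Fin 3 → V) → Fin 3, (∀ x, ¬ D E x (s x)) ∧
      ∀ x y : Fin 3 → V, (∀ t, E (x t) (y t)) → E (x (s x)) (y (s y)) := by
  obtain ⟨T, hP, htot⟩ := exists_pref E
  choose s hs using fun x : Fin 3 → V => exists_sel (M E T x)
  have hcov : ∀ x : Fin 3 → V, (¬ ∃ i, M E T x i) → ∀ i, ¬ D E x i := by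
    intro x hM i hi
    have h : ∀ i, ¬ D E x i → ∃ m, ¬ D E x m ∧ Lt T (x i) (x m) := by
      intro i hi
      by_contra hc
      push Not at hc
      exact hM ⟨i, hi, hc⟩
    obtain ⟨a, ha⟩ := hne x
    obtain ⟨b, hb, hab⟩ := h a ha
    have nab : a ≠ b := by rintro rfl; exact hab.2 hab.1
    have nia : i ≠ a := by rintro rfl; exact ha hi
    have nib : i ≠ b := by rintro rfl; exact hb hi
    have := (cyclic (hne x) hM a b i nab nia.symm nib.symm hab).2
    exact this.2 (hP.sub _ _ (D_R nia hi) |> fun h1 => by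
      have h2 := (cyclic (hne x) hM a b i nab nia.symm nib.symm hab).1
      exact absurd (hP.sub _ _ (D_R nib hi)) h2.2)
  refine ⟨s, ?_, ?_⟩
  · intro x
    rcases hs x with h | h
    · exact h.1.1
    · exact hcov x h.1 _
  · intro x y hxy
    have hxy' : ∀ t, S E true (x t) (y t) := by simpa [S] using hxy
    rcases hs x with hx | hx <;> rcases hs y with hy | hy
    · by_contra hc
      have hn : ¬ S E true (x (s x)) (y (s y)) := by simpa [S] using hc
      have h1 := lemB hP htot hxy' hn hx.1 hy.1
      have h2 := lemB hP htot (rev hxy') (i := s y) (j := s x) (by rwa [S_not]) hy.1 hx.1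
      have := le_antisymm (hx.2 _ h2) (hy.2 _ h1)
      rw [this] at hc
      exact hc (hxy _)
    · have := lemC hP htot (rev hxy') (hne y) hy.1 (i := s y) hx.1
      simpa [S] using this
    · have := lemC hP htot hxy' (hne x) hx.1 (i := s x) hy.1
      simpa [S] using this
    · rw [hx.2, hy.2]; exact hxy 0

/-! Translation between walks and the inductive notions. -/

theorem walk_reach (E : V → V → Prop) (n : ℕ) (x y : ℕ → V) (ε : ℕ → Bool)
    (hx : IsWalkOn E n x ε) (hy : IsWalkOn E n y ε) (ha : AvoidsOn E n x y ε) :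
    Reach E (x 0, y 0) (x n, y n) := by
  induction n with
  | zero => exact .refl
  | succ n ih =>
    refine (ih (fun i hi => hx i (by omega)) (fun i hi => hy i (by omega))
      (fun i hi => ha i (by omega))).tail ⟨ε n, hx n (by omega), hy n (by omega), ?_⟩
    have := ha n (by omega)
    unfold S
    split_ifs at this ⊢ <;> exact this

theorem inv_of_pair {E : V → V → Prop} {u v : V} (h : InvertiblePair E u v) (hne : u ≠ v) :
    Inv E u v := by
  obtain ⟨⟨n, x, y, ε, hx, hy, h1, h2, h3, h4, ha⟩, ⟨n', x', y', ε', hx', hy', h1', h2', h3', h4', ha'⟩⟩ := h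
  refine ⟨hne, ?_, ?_⟩
  · have := walk_reach E n x y ε hx hy ha
    rwa [h1, h2, h3, h4] at this
  · have := walk_reach E n' x' y' ε' hx' hy' ha'
    rwa [h1', h2', h3', h4'] at this

/-- Prepend a value to a sequence. -/
def cons {α : Type*} (a : α) (f : ℕ → α) : ℕ → α
  | 0 => a
  | n + 1 => f n

theorem walk_cons {E : V → V → Prop} {n : ℕ} {x : ℕ → V} {ε : ℕ → Bool} {a : V} {e : Bool}
    (hx : IsWalkOn E n x ε) (h : S E e a (x 0)) : IsWalkOn E (n + 1) (cons a x) (cons e ε) := by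
  intro i hi
  cases i with
  | zero => exact h
  | succ i => exact hx i (by omega)

theorem avoid_cons {E : V → V → Prop} {n : ℕ} {x y : ℕ → V} {ε : ℕ → Bool} {a b : V} {e : Bool}
    (hx : AvoidsOn E n x y ε) (h : ¬ S E e a (y 0)) :
    AvoidsOn E (n + 1) (cons a x) (cons b y) (cons e ε) := by
  intro i hi
  cases i with
  | zero =>
    cases e with
    | true => simpa [S, cons] using h
    | false => simpa [S, cons] using h
  | succ i => exact hx i (by omega)

theorem reach_walk {E : V → V → Prop} {p q : V × V} (h : Reach E p q) :
    ∃ (n : ℕ) (x y : ℕ → V) (ε : ℕ → Bool), IsWalkOn E n x ε ∧ IsWalkOn E n y ε ∧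
      x 0 = p.1 ∧ x n = q.1 ∧ y 0 = p.2 ∧ y n = q.2 ∧ AvoidsOn E n x y ε := by
  induction h using Relation.ReflTransGen.head_induction_on with
  | refl =>
    exact ⟨0, fun _ => q.1, fun _ => q.2, fun _ => true, by intro i hi; omega,
      by intro i hi; omega, rfl, rfl, rfl, rfl, by intro i hi; omega⟩
  | @head a c hac _ ih =>
    obtain ⟨n, x, y, ε, hx, hy, h1, h2, h3, h4, ha⟩ := ih
    obtain ⟨e, e1, e2, e3⟩ := hac
    exact ⟨n + 1, cons a.1 x, cons a.2 y, cons e ε, walk_cons hx (by rwa [h1]),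
      walk_cons hy (by rwa [h3]), rfl, h2, rfl, h4, avoid_cons ha (by rwa [h3])⟩

theorem pair_of_inv {E : V → V → Prop} {u v : V} (h : Inv E u v) : InvertiblePair E u v :=
  ⟨reach_walk h.2.1, reach_walk h.2.2⟩

theorem dist_witness {E : V → V → Prop} {p q r : V} (h : Dist E p q r) :
    ∃ s b, TripleWitness E p q r s b ∧ InvertiblePair E s b := by
  induction h with
  | @base s b h =>
    exact ⟨s, b, ⟨0, fun _ => true, fun _ => s, fun _ => b, fun _ => b, by intro i hi; omega,
      by intro i hi; omega, by intro i hi; omega, rfl, rfl, rfl, rfl, rfl, rfl,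
      by intro i hi; omega, by intro i hi; omega⟩, pair_of_inv h⟩
  | @step p q r p' q' r' e e1 e2 e3 e4 e5 _ ih =>
    obtain ⟨s, b, ⟨n, ε, P, Q, R, hP, hQ, hR, h1, h2, h3, h4, h5, h6, a1, a2⟩, hi⟩ := ih
    exact ⟨s, b, ⟨n + 1, cons e ε, cons p P, cons q Q, cons r R, walk_cons hP (by rwa [h1]),
      walk_cons hQ (by rwa [h3]), walk_cons hR (by rwa [h5]), rfl, h2, rfl, h4, rfl, h6,
      avoid_cons a1 (by rwa [h3]), avoid_cons a2 (by rwa [h5])⟩, hi⟩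

theorem exists_undist {E : V → V → Prop} (hfree : DATFree E) (x : Fin 3 → V) :
    ∃ i, ¬ D E x i := by
  by_contra hc
  push Not at hc
  have h0 := (D_iff (i := 0) (j := 1) (k := 2) (by decide) (by decide) (by decide)).1 (hc 0)
  have h1 := (D_iff (i := 1) (j := 0) (k := 2) (by decide) (by decide) (by decide)).1 (hc 1)
  have h2 := (D_iff (i := 2) (j := 0) (k := 1) (by decide) (by decide) (by decide)).1 (hc 2)
  obtain ⟨s0, b0, w0, i0⟩ := dist_witness h0
  obtain ⟨s1, b1, w1, i1⟩ := dist_witness h1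
  obtain ⟨s2, b2, w2, i2⟩ := dist_witness h2
  exact hfree ⟨x 0, x 1, x 2, s0, b0, s1, b1, s2, b2,
    ⟨h0.ne, h0.swap.ne, h1.swap.ne, w0, w1, w2⟩, i0, i1, i2⟩

end DATProof

/-- A DAT-free digraph admits a conservative ternary polymorphism `g` whose restriction
to `{u,v}` is a majority for every invertible pair `u, v`. -/
theorem datfree_ternary_majority (E : V → V → Prop) (hfree : DATFree E) :
    ∃ g : V → V → V → V, TerPoly E g ∧ TerConservative g ∧
      ∀ u v : V, InvertiblePair E u v →
        ∀ a ∈ ({u, v} : Set V), ∀ b ∈ ({u, v} : Set V),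
          g a a b = a ∧ g a b a = a ∧ g b a a = a := by
  have hU := DATProof.exists_undist hfree
  obtain ⟨s, hs, hpoly⟩ := DATProof.main E hU
  refine ⟨fun a b c => ![a, b, c] (s ![a, b, c]), ?_, ?_, ?_⟩
  · intro a b c a' b' c' h1 h2 h3
    apply hpoly
    intro t
    fin_cases t
    exacts [h1, h2, h3]
  · intro a b c
    have key : ∀ t : Fin 3, ![a, b, c] t = a ∨ ![a, b, c] t = b ∨ ![a, b, c] t = c := by
      intro t
      fin_cases t <;> simp
    exact key _
  · intro u v huv a ha b hb
    by_cases hab : a = b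
    · subst hab
      have key : ∀ t : Fin 3, ![a, a, a] t = a := by
        intro t
        fin_cases t <;> rfl
      exact ⟨key _, key _, key _⟩
    · have hinv : DATProof.Inv E b a := by
        rcases ha with rfl | rfl <;> rcases hb with rfl | rfl
        · exact absurd rfl hab
        · exact (DATProof.inv_of_pair huv hab).symm
        · exact DATProof.inv_of_pair huv (Ne.symm hab)
        · exact absurd rfl hab
      have hd : DATProof.Dist E b a a := .base hinv
      have k1 : s ![a, a, b] ≠ 2 := fun h => hs ![a, a, b] (by
        rw [h]; exact ⟨0, 1, by decide, by decide, by decide, hd⟩)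
      have k2 : s ![a, b, a] ≠ 1 := fun h => hs ![a, b, a] (by
        rw [h]; exact ⟨0, 2, by decide, by decide, by decide, hd⟩)
      have k3 : s ![b, a, a] ≠ 0 := fun h => hs ![b, a, a] (by
        rw [h]; exact ⟨1, 2, by decide, by decide, by decide, hd⟩)
      have z : ∀ t : Fin 3, t = 0 ∨ t = 1 ∨ t = 2 := by decide
      refine ⟨?_, ?_, ?_⟩
      · rcases z (s ![a, a, b]) with h | h | h
        · simp [h]
        · simp [h]
        · exact absurd h k1
      · rcases z (s ![a, b, a]) with h | h | h
        · simp [h]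
        · exact absurd h k2
        · simp [h]
      · rcases z (s ![b, a, a]) with h | h | h
        · exact absurd h k3
        · simp [h]
        · simp [h]
end

section
/- Let H be a digraph and let H^{++} be the digraph with vertex set V(H)^3 and an arc from (u,v,w) to (u',v',w') exactly when either uu', vv', ww' ∈ E(H) and uv' ∉ E(H) and uw' ∉ E(H), or u'u, v'v, w'w ∈ E(H) and v'u ∉ E(H) and w'u ∉ E(H). Then vertices u, v, w of H form a DAT (for some choice of witnesses) if and only if for every permutation x, y, z of u, v, w, there exist vertices s, b of H such that s, b is an invertible pair and (s,b,b) is reachable from (x,y,z) by a directed walk in H^{++}. -/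
variable {V : Type*}

/-- The arc relation of the triple digraph `H⁺⁺` on `V(H)³`: an arc from `(u,v,w)` to
`(u',v',w')` when `uu', vv', ww' ∈ E` and `uv', uw' ∉ E`, or `u'u, v'v, w'w ∈ E` and
`v'u, w'u ∉ E`. -/
def HPPArc (E : V → V → Prop) (p q : V × V × V) : Prop :=
  (E p.1 q.1 ∧ E p.2.1 q.2.1 ∧ E p.2.2 q.2.2 ∧ ¬ E p.1 q.2.1 ∧ ¬ E p.1 q.2.2) ∨
  (E q.1 p.1 ∧ E q.2.1 p.2.1 ∧ E q.2.2 p.2.2 ∧ ¬ E q.2.1 p.1 ∧ ¬ E q.2.2 p.1)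

theorem reach_of_walks_s17 (E : V → V → Prop) (n : ℕ) (ε : ℕ → Bool) (P Q R : ℕ → V)
    (hP : IsWalkOn E n P ε) (hQ : IsWalkOn E n Q ε) (hR : IsWalkOn E n R ε)
    (hPQ : AvoidsOn E n P Q ε) (hPR : AvoidsOn E n P R ε) :
    ∀ m ≤ n, Relation.ReflTransGen (HPPArc E) (P 0, Q 0, R 0) (P m, Q m, R m) := by
  intro m
  induction m with
  | zero => intro _; exact Relation.ReflTransGen.refl
  | succ k ih =>
    intro hk
    refine (ih (by omega)).tail ?_
    have h1 := hP k (by omega)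
    have h2 := hQ k (by omega)
    have h3 := hR k (by omega)
    have h4 := hPQ k (by omega)
    have h5 := hPR k (by omega)
    by_cases he : ε k = true
    · simp only [he, if_true] at h1 h2 h3 h4 h5
      exact Or.inl ⟨h1, h2, h3, h4, h5⟩
    · simp only [he] at h1 h2 h3 h4 h5
      exact Or.inr ⟨h1, h2, h3, h4, h5⟩

theorem tripleWitness_iff (E : V → V → Prop) (x y z s b : V) :
    TripleWitness E x y z s b ↔ Relation.ReflTransGen (HPPArc E) (x, y, z) (s, b, b) := by
  constructor
  · rintro ⟨n, ε, P, Q, R, hP, hQ, hR, rfl, rfl, rfl, hq, rfl, hr, h1, h2⟩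
    have := reach_of_walks_s17 E n ε P Q R hP hQ hR h1 h2 n le_rfl
    rwa [hq, hr] at this
  · intro h
    suffices H : ∀ p : V × V × V, Relation.ReflTransGen (HPPArc E) p (s, b, b) →
        TripleWitness E p.1 p.2.1 p.2.2 s b from H _ h
    intro p hp
    induction hp using Relation.ReflTransGen.head_induction_on with
    | refl =>
      exact ⟨0, fun _ => true, fun _ => s, fun _ => b, fun _ => b, by simp [IsWalkOn, AvoidsOn]⟩
    | head harc hrest ih =>
      rename_i p q
      obtain ⟨n, ε, P, Q, R, hP, hQ, hR, hp0, hpn, hq0, hqn, hr0, hrn, h1, h2⟩ := ih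
      have key : ∀ e : Bool,
          (if e = true then E p.1 q.1 else E q.1 p.1) →
          (if e = true then E p.2.1 q.2.1 else E q.2.1 p.2.1) →
          (if e = true then E p.2.2 q.2.2 else E q.2.2 p.2.2) →
          (if e = true then ¬ E p.1 q.2.1 else ¬ E q.2.1 p.1) →
          (if e = true then ¬ E p.1 q.2.2 else ¬ E q.2.2 p.1) →
          TripleWitness E p.1 p.2.1 p.2.2 s b := by
        intro e a1 a2 a3 a4 a5
        rw [← hp0] at a1
        rw [← hq0] at a2 a4
        rw [← hr0] at a3 a5
        refine ⟨n + 1, fun i => Nat.casesOn i e ε, fun i => Nat.casesOn i p.1 P,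
          fun i => Nat.casesOn i p.2.1 Q, fun i => Nat.casesOn i p.2.2 R,
          ?_, ?_, ?_, rfl, hpn, rfl, hqn, rfl, hrn, ?_, ?_⟩
        · rintro (_ | i) hi
          · exact a1
          · exact hP i (by omega)
        · rintro (_ | i) hi
          · exact a2
          · exact hQ i (by omega)
        · rintro (_ | i) hi
          · exact a3
          · exact hR i (by omega)
        · rintro (_ | i) hi
          · exact a4
          · exact h1 i (by omega)
        · rintro (_ | i) hi
          · exact a5
          · exact h2 i (by omega)
      rcases harc with ⟨a1, a2, a3, a4, a5⟩ | ⟨a1, a2, a3, a4, a5⟩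
      · exact key true (by simpa using a1) (by simpa using a2) (by simpa using a3)
          (by simpa using a4) (by simpa using a5)
      · exact key false (by simpa using a1) (by simpa using a2) (by simpa using a3)
          (by simpa using a4) (by simpa using a5)

theorem tripleWitness_swap (E : V → V → Prop) (x y z s b : V)
    (h : TripleWitness E x y z s b) : TripleWitness E x z y s b := by
  obtain ⟨n, ε, P, Q, R, hP, hQ, hR, hp0, hpn, hq0, hqn, hr0, hrn, h1, h2⟩ := h
  exact ⟨n, ε, P, R, Q, hP, hR, hQ, hp0, hpn, hr0, hrn, hq0, hqn, h2, h1⟩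

/-- Distinct vertices `u, v, w` form a DAT (for some choice of witnesses) iff for every
permutation `x, y, z` of `u, v, w` there is an invertible pair `s, b` such that
`(s,b,b)` is reachable from `(x,y,z)` by a directed walk in `H⁺⁺`. -/
theorem dat_iff_hpp_reachability (E : V → V → Prop) (u v w : V)
    (huv : u ≠ v) (huw : u ≠ w) (hvw : v ≠ w) :
    (∃ su bu sv bv sw bw : V, IsDAT E u v w su bu sv bv sw bw) ↔
      (∀ x y z : V,
        ((x, y, z) = (u, v, w) ∨ (x, y, z) = (u, w, v) ∨ (x, y, z) = (v, u, w) ∨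
         (x, y, z) = (v, w, u) ∨ (x, y, z) = (w, u, v) ∨ (x, y, z) = (w, v, u)) →
        ∃ s b : V, InvertiblePair E s b ∧
          Relation.ReflTransGen (HPPArc E) (x, y, z) (s, b, b)) := by
  simp only [← tripleWitness_iff]
  constructor
  · rintro ⟨su, bu, sv, bv, sw, bw, ⟨_, _, _, tu, tv, tw⟩, iu, iv, iw⟩ x y z h
    simp only [Prod.mk.injEq] at h
    rcases h with ⟨rfl, rfl, rfl⟩ | ⟨rfl, rfl, rfl⟩ | ⟨rfl, rfl, rfl⟩ | ⟨rfl, rfl, rfl⟩ |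
      ⟨rfl, rfl, rfl⟩ | ⟨rfl, rfl, rfl⟩
    · exact ⟨su, bu, iu, tu⟩
    · exact ⟨su, bu, iu, tripleWitness_swap _ _ _ _ _ _ tu⟩
    · exact ⟨sv, bv, iv, tv⟩
    · exact ⟨sv, bv, iv, tripleWitness_swap _ _ _ _ _ _ tv⟩
    · exact ⟨sw, bw, iw, tw⟩
    · exact ⟨sw, bw, iw, tripleWitness_swap _ _ _ _ _ _ tw⟩
  · intro h
    obtain ⟨su, bu, iu, tu⟩ := h u v w (by simp)
    obtain ⟨sv, bv, iv, tv⟩ := h v u w (by simp)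
    obtain ⟨sw, bw, iw, tw⟩ := h w u v (by simp)
    exact ⟨su, bu, sv, bv, sw, bw, ⟨huv, huw, hvw, tu, tv, tw⟩, iu, iv, iw⟩
end
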